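/- arXiv:1111.2241 — 7 statements merged into one kernel-verified Lean document; each statement's English description precedes it below -/
import Mathlib

section
/- Let ω, λ > 0 and u_{1s}, u_{2s} > 0. Consider the points m_u = (u_{1s}, 0, 0, −λu_{2s}) and m_s = (u_{1s}, 0, 0, λu_{2s}) on the section {u₂ = 0}. Then: (i) the solution of the linear system with value m_u at t = 0 converges to P = (u_{1s}, u_{2s}, 0, 0) as t → −∞ and satisfies 0 < u₂(t) < u_{2s} for all t < 0; (ii) the solution with value m_s at t = 0 converges to P as t → +∞ and satisfies 0 < u₂(t) < u_{2s} for all t > 0; (iii) the billiard reflection from the boundary {u₂ = 0} (the map (v₁, v₂) ↦ (v₁, −v₂)) sends the velocity of m_u to the velocity of m_s. Hence, when the lower wall is perpendicular to the unstable direction (θ = 0), the unstable separatrix of P reflects after one impact exactly onto the stable separatrix, forming a homoclinic orbit of the impact system. -/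
open Filter

theorem eq_mul_exp_of_hasDerivAt {f : ℝ → ℝ} {a : ℝ}
    (hf : ∀ t, HasDerivAt f (a * f t) t) (t : ℝ) : f t = f 0 * Real.exp (a * t) := by
  have hderiv : ∀ s, HasDerivAt (fun s => f s * Real.exp (-a * s)) 0 s := fun s => by
    have he : HasDerivAt (fun s => Real.exp (-a * s)) (Real.exp (-a * s) * (-a * 1)) s :=
      ((hasDerivAt_id s).const_mul (-a)).exp
    exact ((hf s).fun_mul he).congr_deriv (by ring)
  have hconst := is_const_of_deriv_eq_zero (fun s => (hderiv s).differentiableAt)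
    (fun s => (hderiv s).deriv) t 0
  simp only [mul_zero, Real.exp_zero, mul_one] at hconst
  rw [← hconst, mul_assoc, ← Real.exp_add]
  simp

/-- A harmonic oscillator starting at rest at its equilibrium stays there. -/
theorem harmonic_eq_equilibrium {u v : ℝ → ℝ} {ω c : ℝ} (hω : ω ≠ 0)
    (hu : ∀ t, HasDerivAt u (v t) t) (hv : ∀ t, HasDerivAt v (-ω ^ 2 * (u t - c)) t)
    (hu0 : u 0 = c) (hv0 : v 0 = 0) (t : ℝ) : u t = c ∧ v t = 0 := by
  have hderiv : ∀ s, HasDerivAt (fun s => v s ^ 2 + ω ^ 2 * (u s - c) ^ 2) 0 s := fun s => by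
    exact (((hv s).fun_pow 2).fun_add
      ((((hu s).sub_const c).fun_pow 2).const_mul (ω ^ 2))).congr_deriv (by ring)
  have hconst := is_const_of_deriv_eq_zero (fun s => (hderiv s).differentiableAt)
    (fun s => (hderiv s).deriv) t 0
  simp only [hu0, hv0] at hconst
  have hvt : v t ^ 2 = 0 := by nlinarith [sq_nonneg (v t), sq_nonneg (ω * (u t - c))]
  have hut : ω * (u t - c) = 0 := by
    have : (ω * (u t - c)) ^ 2 = 0 := by nlinarith
    simpa using this
  exact ⟨sub_eq_zero.mp ((mul_eq_zero.mp hut).resolve_left hω), by simpa using hvt⟩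

/-- A solution of the saddle equation with rate `a` and center `c` starting on
the line `v = -a (u - c)` stays on it. -/
theorem saddle_eq_exp {u v : ℝ → ℝ} {a c : ℝ}
    (hu : ∀ t, HasDerivAt u (v t) t) (hv : ∀ t, HasDerivAt v (a ^ 2 * (u t - c)) t)
    (h0 : v 0 = -a * (u 0 - c)) (t : ℝ) :
    u t = c + (u 0 - c) * Real.exp (-a * t) ∧
      v t = -a * ((u 0 - c) * Real.exp (-a * t)) := by
  have hw : ∀ s, v s + a * (u s - c) = 0 := fun s => by
    have := eq_mul_exp_of_hasDerivAt (f := fun s => v s + a * (u s - c)) (a := a) (fun s =>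
      ((hv s).fun_add (((hu s).sub_const c).const_mul a)).congr_deriv (by ring)) s
    rw [this, h0]
    ring
  have hsub := eq_mul_exp_of_hasDerivAt (f := fun s => u s - c) (a := -a) (fun s =>
    ((hu s).sub_const c).congr_deriv (by linarith [hw s])) t
  exact ⟨by linarith, by rw [← hsub]; linarith [hw t]⟩

/-- The solution through `(c₁, 0, 0, a c₂)` converges to the saddle-center along every filter
on which `exp (-a t)` decays, and `0 < u₂ < c₂` where `a t > 0`. -/
theorem separatrix_tendsto_and_bounds {ω a c₁ c₂ : ℝ} (hω : ω ≠ 0) (hc₂ : 0 < c₂)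
    {u₁ u₂ v₁ v₂ : ℝ → ℝ}
    (hu₁ : ∀ t, HasDerivAt u₁ (v₁ t) t) (hu₂ : ∀ t, HasDerivAt u₂ (v₂ t) t)
    (hv₁ : ∀ t, HasDerivAt v₁ (-ω ^ 2 * (u₁ t - c₁)) t)
    (hv₂ : ∀ t, HasDerivAt v₂ (a ^ 2 * (u₂ t - c₂)) t)
    (h0 : u₁ 0 = c₁ ∧ u₂ 0 = 0 ∧ v₁ 0 = 0 ∧ v₂ 0 = a * c₂)
    {l : Filter ℝ} (hl : Tendsto (fun t => a * t) l atTop) :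
    Tendsto (fun t => (u₁ t, u₂ t, v₁ t, v₂ t)) l (nhds (c₁, c₂, 0, 0)) ∧
      ∀ t, 0 < a * t → 0 < u₂ t ∧ u₂ t < c₂ := by
  obtain ⟨hu₁0, hu₂0, hv₁0, hv₂0⟩ := h0
  have hcenter := harmonic_eq_equilibrium hω hu₁ hv₁ hu₁0 hv₁0
  have hsaddle := saddle_eq_exp hu₂ hv₂ (by rw [hv₂0, hu₂0]; ring)
  simp only [hu₂0] at hsaddle
  constructor
  · have hexp : Tendsto (fun t => Real.exp (-a * t)) l (nhds 0) := by
      simpa [Function.comp_def] using Real.tendsto_exp_neg_atTop_nhds_zero.comp hl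
    have hdecay := hexp.const_mul (0 - c₂)
    simp only [hcenter, hsaddle]
    refine tendsto_const_nhds.prodMk_nhds (Tendsto.prodMk_nhds ?_
      (tendsto_const_nhds.prodMk_nhds ?_))
    · simpa using hdecay.const_add c₂
    · simpa using hdecay.const_mul (-a)
  · intro t ht
    have hlt : Real.exp (-a * t) < 1 := Real.exp_lt_one_iff.mpr (by linarith)
    have hpos := Real.exp_pos (-a * t)
    rw [(hsaddle t).1]
    constructor <;> nlinarith

/-- For `θ = 0`: (i) the solution of the linear system through
`m_u = (u_{1s}, 0, 0, −λ u_{2s})` converges to `P = (u_{1s}, u_{2s}, 0, 0)` as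
`t → −∞` with `0 < u₂(t) < u_{2s}` for `t < 0`; (ii) the solution through
`m_s = (u_{1s}, 0, 0, λ u_{2s})` converges to `P` as `t → +∞` with
`0 < u₂(t) < u_{2s}` for `t > 0`; (iii) the reflection `(v₁, v₂) ↦ (v₁, −v₂)`
from the wall `{u₂ = 0}` sends the velocity of `m_u` to that of `m_s`. Hence
the unstable separatrix reflects after one impact onto the stable separatrix,
forming a homoclinic orbit of the impact system. -/
theorem perpendicular_wall_homoclinic_orbit
    (ω lam u1s u2s : ℝ) (hω : 0 < ω) (hlam : 0 < lam)
    (h1s : 0 < u1s) (h2s : 0 < u2s) :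
    (∀ u₁ u₂ v₁ v₂ : ℝ → ℝ,
      (∀ t, HasDerivAt u₁ (v₁ t) t) → (∀ t, HasDerivAt u₂ (v₂ t) t) →
      (∀ t, HasDerivAt v₁ (-ω ^ 2 * (u₁ t - u1s)) t) →
      (∀ t, HasDerivAt v₂ (lam ^ 2 * (u₂ t - u2s)) t) →
      (u₁ 0 = u1s ∧ u₂ 0 = 0 ∧ v₁ 0 = 0 ∧ v₂ 0 = -(lam * u2s)) →
      (Tendsto (fun t => (u₁ t, u₂ t, v₁ t, v₂ t)) atBot
          (nhds (u1s, u2s, 0, 0)) ∧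
        ∀ t < (0 : ℝ), 0 < u₂ t ∧ u₂ t < u2s)) ∧
    (∀ u₁ u₂ v₁ v₂ : ℝ → ℝ,
      (∀ t, HasDerivAt u₁ (v₁ t) t) → (∀ t, HasDerivAt u₂ (v₂ t) t) →
      (∀ t, HasDerivAt v₁ (-ω ^ 2 * (u₁ t - u1s)) t) →
      (∀ t, HasDerivAt v₂ (lam ^ 2 * (u₂ t - u2s)) t) →
      (u₁ 0 = u1s ∧ u₂ 0 = 0 ∧ v₁ 0 = 0 ∧ v₂ 0 = lam * u2s) →
      (Tendsto (fun t => (u₁ t, u₂ t, v₁ t, v₂ t)) atTop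
          (nhds (u1s, u2s, 0, 0)) ∧
        ∀ t > (0 : ℝ), 0 < u₂ t ∧ u₂ t < u2s)) ∧
    (((0 : ℝ), -(-(lam * u2s))) = ((0 : ℝ), lam * u2s)) := by
  refine ⟨fun u₁ u₂ v₁ v₂ hu₁ hu₂ hv₁ hv₂ h0 => ?_, fun u₁ u₂ v₁ v₂ hu₁ hu₂ hv₁ hv₂ h0 => ?_,
    by simp⟩
  · have h := separatrix_tendsto_and_bounds (a := -lam) hω.ne' h2s hu₁ hu₂ hv₁
      (by simpa using hv₂) (by simpa using h0)
      (tendsto_id.const_mul_atBot_of_neg (neg_neg_of_pos hlam))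
    exact ⟨h.1, fun t ht => h.2 t (mul_pos_of_neg_of_neg (neg_neg_of_pos hlam) ht)⟩
  · have h := separatrix_tendsto_and_bounds hω.ne' h2s hu₁ hu₂ hv₁ hv₂ h0
      (tendsto_id.const_mul_atTop hlam)
    exact ⟨h.1, fun t ht => h.2 t (mul_pos hlam ht)⟩
end

section
/- Let ω, λ > 0 and u_{2s} > 0. Let t ↦ (u₁(t), u₂(t), v₁(t), v₂(t)) be a solution of the linear system with u₂(0) = 0, v₂(0) > 0, and D₂(u₂(0), v₂(0)) < 0. Then there exists T > 0 such that u₂(T) = 0, v₂(T) = −v₂(0), and 0 < u₂(t) < u_{2s} for all t ∈ (0, T). That is, every non-reacting orbit starting on the wall u₂ = 0 with upward velocity returns to the wall after a finite time with its hyperbolic velocity component reversed. -/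
/-- A solution of `f' = k f` on `ℝ` is an exponential. -/
theorem eq_mul_exp_of_hasDerivAt_mul {k : ℝ} {f : ℝ → ℝ}
    (hf : ∀ t, HasDerivAt f (k * f t) t) (t : ℝ) : f t = f 0 * Real.exp (k * t) := by
  have hd : ∀ x, HasDerivAt (fun y => f y * Real.exp (-(k * y))) 0 x := fun x => by
    have he := ((hasDerivAt_id x).const_mul k).neg.exp
    refine ((hf x).mul he).congr_deriv ?_
    simp only [Pi.neg_apply, id]
    ring
  have hc := is_const_of_deriv_eq_zero (fun x => (hd x).differentiableAt)
    (fun x => (hd x).deriv) t 0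
  simp only [mul_zero, neg_zero, Real.exp_zero, mul_one] at hc
  rw [← hc, mul_assoc, ← Real.exp_add, neg_add_cancel, Real.exp_zero, mul_one]


/-- Every non-reacting orbit (`D₂ < 0`) of the linear system starting on the
wall `u₂ = 0` with upward velocity `v₂(0) > 0` returns to the wall after a
finite time `T > 0` with its hyperbolic velocity component reversed,
`v₂(T) = −v₂(0)`, staying in the strip `0 < u₂ < u_{2s}` in between. -/
theorem nonreacting_orbit_returns_to_wall
    (ω lam u1s u2s : ℝ) (hω : 0 < ω) (hlam : 0 < lam) (h2s : 0 < u2s)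
    (u₁ u₂ v₁ v₂ : ℝ → ℝ)
    (hu₁ : ∀ t, HasDerivAt u₁ (v₁ t) t)
    (hu₂ : ∀ t, HasDerivAt u₂ (v₂ t) t)
    (hv₁ : ∀ t, HasDerivAt v₁ (-ω ^ 2 * (u₁ t - u1s)) t)
    (hv₂ : ∀ t, HasDerivAt v₂ (lam ^ 2 * (u₂ t - u2s)) t)
    (h0 : u₂ 0 = 0) (hv0 : 0 < v₂ 0)
    (hD2 : (v₂ 0) ^ 2 / 2 - lam ^ 2 / 2 * (u₂ 0 - u2s) ^ 2 < 0) :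
    ∃ T > (0 : ℝ), u₂ T = 0 ∧ v₂ T = -(v₂ 0) ∧
      ∀ t ∈ Set.Ioo (0 : ℝ) T, 0 < u₂ t ∧ u₂ t < u2s := by
  have hlt : v₂ 0 < lam * u2s := by
    refine lt_of_pow_lt_pow_left₀ 2 (by positivity) ?_
    rw [h0] at hD2
    linarith [mul_pow lam u2s 2, show (0 - u2s) ^ 2 = u2s ^ 2 by ring]
  have ha (t : ℝ) : v₂ t + lam * (u₂ t - u2s) =
      -(lam * u2s - v₂ 0) * Real.exp (lam * t) := by
    have h := eq_mul_exp_of_hasDerivAt_mul (k := lam)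
      (f := fun t => v₂ t + lam * (u₂ t - u2s))
      (fun t => ((hv₂ t).add (((hu₂ t).sub_const u2s).const_mul lam)).congr_deriv (by ring)) t
    simp only [h0] at h
    rw [h]
    ring
  have hb (t : ℝ) : v₂ t - lam * (u₂ t - u2s) =
      (lam * u2s + v₂ 0) * (Real.exp (lam * t))⁻¹ := by
    have h := eq_mul_exp_of_hasDerivAt_mul (k := -lam)
      (f := fun t => v₂ t - lam * (u₂ t - u2s))
      (fun t => ((hv₂ t).sub (((hu₂ t).sub_const u2s).const_mul lam)).congr_deriv (by ring)) t
    simp only [h0, neg_mul, Real.exp_neg] at h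
    rw [h]
    ring
  have hp : 0 < lam * u2s - v₂ 0 := by linarith
  have hq : 0 < lam * u2s + v₂ 0 := by linarith
  have hr : 1 < (lam * u2s + v₂ 0) / (lam * u2s - v₂ 0) := by
    rw [one_lt_div hp]
    linarith
  set T := Real.log ((lam * u2s + v₂ 0) / (lam * u2s - v₂ 0)) / lam with hT
  have hexp : Real.exp (lam * T) = (lam * u2s + v₂ 0) / (lam * u2s - v₂ 0) := by
    rw [hT, mul_div_cancel₀ _ hlam.ne', Real.exp_log (by positivity)]
  have haT : v₂ T + lam * (u₂ T - u2s) = -(lam * u2s + v₂ 0) := by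
    rw [ha, hexp]
    field_simp
  have hbT : v₂ T - lam * (u₂ T - u2s) = lam * u2s - v₂ 0 := by
    rw [hb, hexp]
    field_simp
  refine ⟨T, div_pos (Real.log_pos hr) hlam, ?_, by linarith, fun t ht => ?_⟩
  · refine (mul_eq_zero.mp (?_ : lam * u₂ T = 0)).resolve_left hlam.ne'
    linarith
  · have hE1 : 1 < Real.exp (lam * t) := Real.one_lt_exp_iff.mpr (mul_pos hlam ht.1)
    have hE2 : Real.exp (lam * t) < (lam * u2s + v₂ 0) / (lam * u2s - v₂ 0) :=
      hexp ▸ Real.exp_lt_exp.mpr (mul_lt_mul_of_pos_left ht.2 hlam)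
    have hat := ha t
    have hbt := hb t
    generalize Real.exp (lam * t) = E at hE1 hE2 hat hbt
    have hE0 : 0 < E := by linarith
    rw [lt_div_iff₀ hp] at hE2
    constructor
    · refine pos_of_mul_pos_right (?_ : 0 < 2 * lam * u₂ t) (by positivity)
      have hfac : 2 * lam * u₂ t =
          (E - 1) * ((lam * u2s + v₂ 0) - E * (lam * u2s - v₂ 0)) / E := by
        have : 2 * lam * u₂ t = 2 * lam * u2s - (lam * u2s - v₂ 0) * E
            - (lam * u2s + v₂ 0) * E⁻¹ := by linarith
        rw [this]
        field_simp
        ring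
      rw [hfac]
      exact div_pos (mul_pos (by linarith) (by linarith)) hE0
    · have h1 : 0 < (lam * u2s - v₂ 0) * E := by positivity
      have h2 : 0 < (lam * u2s + v₂ 0) * E⁻¹ := by positivity
      exact lt_of_mul_lt_mul_left (by linarith : lam * u₂ t < lam * u2s) hlam.le
end

section
/- Let ω, λ > 0 and (u_{1s}, u_{2s}) ∈ ℝ². Let t ↦ (u₁(t), u₂(t), v₁(t), v₂(t)) be a solution of the linear system with D₂(u₂(0), v₂(0)) < 0 and u₂(0) < u_{2s}. Then u₂(t) < u_{2s} for all t ∈ ℝ: the trajectory never crosses the dividing surface u₂ = u_{2s} ('motion without reaction'). -/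
/-- Conservation of `D₂` along solutions of the saddle part of the linear system. -/
theorem saddle_energy_eq {lam c : ℝ} {u v : ℝ → ℝ}
    (hu : ∀ t, HasDerivAt u (v t) t)
    (hv : ∀ t, HasDerivAt v (lam ^ 2 * (u t - c)) t) (s t : ℝ) :
    v s ^ 2 / 2 - lam ^ 2 / 2 * (u s - c) ^ 2 = v t ^ 2 / 2 - lam ^ 2 / 2 * (u t - c) ^ 2 := by
  have hD : ∀ r, HasDerivAt (fun r => v r ^ 2 / 2 - lam ^ 2 / 2 * (u r - c) ^ 2) 0 r := by
    intro r
    refine ((((hv r).fun_pow 2).div_const 2).fun_sub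
      ((((hu r).sub_const c).fun_pow 2).const_mul (lam ^ 2 / 2))).congr_deriv ?_
    push_cast
    ring
  exact is_const_of_deriv_eq_zero (fun r => (hD r).differentiableAt) (fun r => (hD r).deriv) s t

/-- A non-reacting orbit of the linear system (`D₂(u₂(0), v₂(0)) < 0`) starting
with `u₂(0) < u_{2s}` never crosses the dividing surface `u₂ = u_{2s}`:
motion without reaction. -/
theorem nonreacting_orbit_never_crosses
    (ω lam u1s u2s : ℝ) (hω : 0 < ω) (hlam : 0 < lam)
    (u₁ u₂ v₁ v₂ : ℝ → ℝ)
    (hu₁ : ∀ t, HasDerivAt u₁ (v₁ t) t)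
    (hu₂ : ∀ t, HasDerivAt u₂ (v₂ t) t)
    (hv₁ : ∀ t, HasDerivAt v₁ (-ω ^ 2 * (u₁ t - u1s)) t)
    (hv₂ : ∀ t, HasDerivAt v₂ (lam ^ 2 * (u₂ t - u2s)) t)
    (hD2 : (v₂ 0) ^ 2 / 2 - lam ^ 2 / 2 * (u₂ 0 - u2s) ^ 2 < 0)
    (h0 : u₂ 0 < u2s) :
    ∀ t : ℝ, u₂ t < u2s := by
  intro t
  by_contra! ht
  have hcont : Continuous u₂ := continuous_iff_continuousAt.2 fun r => (hu₂ r).continuousAt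
  obtain ⟨s, hs⟩ := mem_range_of_exists_le_of_exists_ge hcont ⟨0, h0.le⟩ ⟨t, ht⟩
  have hE := saddle_energy_eq hu₂ hv₂ s 0
  rw [hs, sub_self] at hE
  nlinarith [sq_nonneg (v₂ s)]
end

section
/- Let ω, λ > 0, μ ≠ 0, h > 0, and u_{1s}, u_{2s} ∈ ℝ with u_{2s} − μu_{1s} > 0. Define σ = ω²λ²(u_{2s} − μu_{1s})²/(2(ω² + μ⁴λ²)). Then the equation √(2h)·(cos φ − μ²(λ/ω)·sin φ) = −μλ(u_{2s} − μu_{1s}) has: no solution φ ∈ [0, 2π) when 0 < h < σμ²; exactly one solution φ ∈ [0, 2π) when h = σμ²; and exactly two solutions φ ∈ [0, 2π) when h > σμ². (These solutions correspond respectively to no simple homoclinic orbit, a tangent homoclinic orbit, and two transverse homoclinic orbits of the Lyapunov periodic orbit γ_h of the impact system.) -/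
/-- Every point of the unit circle has an angle in `[0, 2π)`. -/
theorem exists_mem_Ico_cos_eq_sin_eq {x y : ℝ} (h : x ^ 2 + y ^ 2 = 1) :
    ∃ φ ∈ Set.Ico (0 : ℝ) (2 * Real.pi), Real.cos φ = x ∧ Real.sin φ = y := by
  have hnorm : ‖(⟨x, y⟩ : ℂ)‖ = 1 := by
    rw [Complex.norm_def, Complex.normSq_mk, ← sq, ← sq, h, Real.sqrt_one]
  have hne : (⟨x, y⟩ : ℂ) ≠ 0 := norm_ne_zero_iff.1 (by rw [hnorm]; exact one_ne_zero)
  refine ⟨toIcoMod Real.two_pi_pos 0 (Complex.arg ⟨x, y⟩), ?_, ?_, ?_⟩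
  · simpa using toIcoMod_mem_Ico Real.two_pi_pos 0 (Complex.arg ⟨x, y⟩)
  · rw [toIcoMod, zsmul_eq_mul, Real.cos_sub_int_mul_two_pi, Complex.cos_arg hne, hnorm, div_one]
  · rw [toIcoMod, zsmul_eq_mul, Real.sin_sub_int_mul_two_pi, Complex.sin_arg, hnorm, div_one]

/-- An angle in `[0, 2π)` is determined by its cosine and sine. -/
theorem eq_of_mem_Ico_of_cos_eq_of_sin_eq {a b : ℝ} (ha : a ∈ Set.Ico (0 : ℝ) (2 * Real.pi))
    (hb : b ∈ Set.Ico (0 : ℝ) (2 * Real.pi)) (hcos : Real.cos a = Real.cos b)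
    (hsin : Real.sin a = Real.sin b) : a = b := by
  have h : Real.cos (a - b) = 1 := by
    rw [Real.cos_sub, hcos, hsin, ← sq, ← sq, Real.cos_sq_add_sin_sq]
  have := (Real.cos_eq_one_iff_of_lt_of_lt (by linarith [ha.1, hb.2]) (by linarith [ha.2, hb.1])).1 h
  linarith

/-- The solutions of `A cos φ + B sin φ = C` in `[0, 2π)` correspond, via
`φ ↦ A sin φ - B cos φ`, to the square roots of `A² + B² - C²`. -/
theorem encard_linear_trig_eq {A B C : ℝ} (hAB : 0 < A ^ 2 + B ^ 2) :
    {φ ∈ Set.Ico (0 : ℝ) (2 * Real.pi) | A * Real.cos φ + B * Real.sin φ = C}.encard =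
      {t : ℝ | t ^ 2 = A ^ 2 + B ^ 2 - C ^ 2}.encard := by
  have hinj : Set.InjOn (fun φ => A * Real.sin φ - B * Real.cos φ)
      {φ ∈ Set.Ico (0 : ℝ) (2 * Real.pi) | A * Real.cos φ + B * Real.sin φ = C} := by
    rintro a ⟨ha, hae⟩ b ⟨hb, hbe⟩ hab
    dsimp only at hab
    refine eq_of_mem_Ico_of_cos_eq_of_sin_eq ha hb (mul_left_cancel₀ hAB.ne' ?_)
      (mul_left_cancel₀ hAB.ne' ?_)
    · linear_combination A * (hae - hbe) - B * hab
    · linear_combination B * (hae - hbe) + A * hab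
  rw [← hinj.encard_image]
  congr 1
  ext t
  constructor
  · rintro ⟨φ, ⟨-, rfl⟩, rfl⟩
    change _ ^ 2 = _
    linear_combination (A ^ 2 + B ^ 2) * Real.cos_sq_add_sin_sq φ
  · intro (ht : t ^ 2 = _)
    have hcirc : ((A * C - B * t) / (A ^ 2 + B ^ 2)) ^ 2 +
        ((B * C + A * t) / (A ^ 2 + B ^ 2)) ^ 2 = 1 := by
      field_simp
      linear_combination (A ^ 2 + B ^ 2) * ht
    obtain ⟨φ, hφ, hcos, hsin⟩ := exists_mem_Ico_cos_eq_sin_eq hcirc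
    refine ⟨φ, ⟨hφ, ?_⟩, ?_⟩
    · rw [hcos, hsin]
      field_simp
      ring
    · dsimp only
      rw [hcos, hsin]
      field_simp
      ring

/-- Homoclinic bifurcation equation: with
`σ = ω²λ²(u_{2s} − μu_{1s})²/(2(ω² + μ⁴λ²))`, the equation
`√(2h)(cos φ − μ²(λ/ω) sin φ) = −μλ(u_{2s} − μu_{1s})` has no solution in
`[0, 2π)` for `0 < h < σμ²`, exactly one for `h = σμ²`, and exactly two for
`h > σμ²` — corresponding to no simple homoclinic orbit, a tangent homoclinic
orbit, and two transverse homoclinic orbits of the Lyapunov orbit `γ_h`. -/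
theorem homoclinic_bifurcation_equation_solution_count
    (ω lam μ h u1s u2s : ℝ) (hω : 0 < ω) (hlam : 0 < lam) (hμ : μ ≠ 0)
    (hh : 0 < h) (hpos : 0 < u2s - μ * u1s)
    (σ : ℝ)
    (hσ : σ = ω ^ 2 * lam ^ 2 * (u2s - μ * u1s) ^ 2 /
      (2 * (ω ^ 2 + μ ^ 4 * lam ^ 2))) :
    (h < σ * μ ^ 2 →
      {φ ∈ Set.Ico (0 : ℝ) (2 * Real.pi) |
        Real.sqrt (2 * h) * (Real.cos φ - μ ^ 2 * (lam / ω) * Real.sin φ) =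
          -(μ * lam * (u2s - μ * u1s))}.encard = 0) ∧
    (h = σ * μ ^ 2 →
      {φ ∈ Set.Ico (0 : ℝ) (2 * Real.pi) |
        Real.sqrt (2 * h) * (Real.cos φ - μ ^ 2 * (lam / ω) * Real.sin φ) =
          -(μ * lam * (u2s - μ * u1s))}.encard = 1) ∧
    (σ * μ ^ 2 < h →
      {φ ∈ Set.Ico (0 : ℝ) (2 * Real.pi) |
        Real.sqrt (2 * h) * (Real.cos φ - μ ^ 2 * (lam / ω) * Real.sin φ) =
          -(μ * lam * (u2s - μ * u1s))}.encard = 2) := by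
  have hsqrt : Real.sqrt (2 * h) ^ 2 = 2 * h := Real.sq_sqrt (by positivity)
  have hden : 0 < ω ^ 2 + μ ^ 4 * lam ^ 2 := by positivity
  have hcard : {φ ∈ Set.Ico (0 : ℝ) (2 * Real.pi) |
        Real.sqrt (2 * h) * (Real.cos φ - μ ^ 2 * (lam / ω) * Real.sin φ) =
          -(μ * lam * (u2s - μ * u1s))}.encard =
      {t : ℝ | t ^ 2 = 2 * (ω ^ 2 + μ ^ 4 * lam ^ 2) / ω ^ 2 * (h - σ * μ ^ 2)}.encard := by
    have hdisc : 2 * (ω ^ 2 + μ ^ 4 * lam ^ 2) / ω ^ 2 * (h - σ * μ ^ 2) =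
        Real.sqrt (2 * h) ^ 2 + (-(Real.sqrt (2 * h) * (μ ^ 2 * (lam / ω)))) ^ 2 -
          (-(μ * lam * (u2s - μ * u1s))) ^ 2 := by
      rw [neg_sq, mul_pow, hsqrt, hσ]
      field_simp
    rw [hdisc, ← encard_linear_trig_eq (by positivity)]
    congr! 5
    ring
  have hcoef : 0 < 2 * (ω ^ 2 + μ ^ 4 * lam ^ 2) / ω ^ 2 := by positivity
  rw [hcard]
  refine ⟨fun hlt => ?_, fun heq => ?_, fun hgt => ?_⟩
  · rw [Set.encard_eq_zero, Set.eq_empty_iff_forall_notMem]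
    intro t (ht : t ^ 2 = _)
    have := mul_neg_of_pos_of_neg hcoef (sub_neg.2 hlt)
    linarith [sq_nonneg t]
  · rw [Set.encard_eq_one]
    exact ⟨0, by ext t; simp [heq]⟩
  · set D := 2 * (ω ^ 2 + μ ^ 4 * lam ^ 2) / ω ^ 2 * (h - σ * μ ^ 2)
    have hD : 0 < D := mul_pos hcoef (sub_pos.2 hgt)
    have hs : 0 < Real.sqrt D := Real.sqrt_pos.2 hD
    rw [Set.encard_eq_two]
    refine ⟨Real.sqrt D, -Real.sqrt D, by linarith, ?_⟩
    ext t
    rw [Set.mem_ofPred_eq, Set.mem_insert_iff, Set.mem_singleton_iff, ← sq_eq_sq_iff_eq_or_eq_neg,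
      Real.sq_sqrt hD.le]
end

section
/- Let ω, λ > 0, δ = ω/λ, and let t = tan(β+θ) satisfy 0 < t < δ. Let u_{1s}, u_{2s} > 0 and set u₁⁺ = u_{1s} + (t·u_{1s} − u_{2s})/(δ − t). Suppose (u₁, u₂, v₁, v₂) ∈ ℝ⁴ satisfies H_lin(u₁, u₂, v₁, v₂) ≤ 0, u₂ > u_{2s}, and u₂ ≤ u₁·t (i.e. the configuration point lies in the wedge, below the upper boundary ray u₂ = u₁ tan(β+θ)). Then u₁ ≤ u₁⁺. Consequently, for ω/λ large enough that u₁⁺ < L, any orbit of energy ≤ 0 staying below the upper wall with u₂ > u_{2s} has u₁ bounded by u₁⁺ < L, so the upper branches of the stable and unstable manifolds of P cannot exit the corner region of size L through the product channel. -/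
/-- The region of nonpositive energy above the saddle lies above the zero level line of slope
`ω / lam`. -/
theorem omega_mul_sub_le_of_energy_nonpos {ω lam u1s u2s u₁ u₂ v₁ v₂ : ℝ} (hlam : 0 < lam)
    (hE : (v₁ ^ 2 + v₂ ^ 2) / 2 + ω ^ 2 / 2 * (u₁ - u1s) ^ 2 -
      lam ^ 2 / 2 * (u₂ - u2s) ^ 2 ≤ 0) (hu₂ : u2s < u₂) :
    ω * (u₁ - u1s) ≤ lam * (u₂ - u2s) := by
  refine le_of_abs_le (abs_le_of_sq_le_sq ?_ (mul_nonneg hlam.le (sub_nonneg.2 hu₂.le)))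
  linarith [sq_nonneg v₁, sq_nonneg v₂, mul_pow ω (u₁ - u1s) 2, mul_pow lam (u₂ - u2s) 2]

/-- Trapping of the upper branches: if `δ = ω/λ`, `0 < tan(β+θ) = t < δ`, and a
phase point has energy `H_lin ≤ 0`, lies above the dividing line
(`u₂ > u_{2s}`), and below the upper wall (`u₂ ≤ u₁·t`), then
`u₁ ≤ u₁⁺ = u_{1s} + (t·u_{1s} − u_{2s})/(δ − t)`. Consequently, when `ω/λ` is
large enough that `u₁⁺ < L`, any such orbit has `u₁ < L`: the upper branches
of the stable and unstable manifolds of `P` cannot exit the corner region of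
size `L` through the product channel. -/
theorem upper_branches_trapped
    (ω lam u1s u2s L t δ u1p : ℝ) (hω : 0 < ω) (hlam : 0 < lam)
    (hδ : δ = ω / lam) (ht0 : 0 < t) (htδ : t < δ)
    (h1s : 0 < u1s) (h2s : 0 < u2s)
    (hu1p : u1p = u1s + (t * u1s - u2s) / (δ - t)) :
    (∀ u₁ u₂ v₁ v₂ : ℝ,
      (v₁ ^ 2 + v₂ ^ 2) / 2 + ω ^ 2 / 2 * (u₁ - u1s) ^ 2 -
          lam ^ 2 / 2 * (u₂ - u2s) ^ 2 ≤ 0 →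
      u2s < u₂ → u₂ ≤ u₁ * t → u₁ ≤ u1p) ∧
    (u1p < L →
      ∀ u₁ u₂ v₁ v₂ : ℝ,
        (v₁ ^ 2 + v₂ ^ 2) / 2 + ω ^ 2 / 2 * (u₁ - u1s) ^ 2 -
            lam ^ 2 / 2 * (u₂ - u2s) ^ 2 ≤ 0 →
        u2s < u₂ → u₂ ≤ u₁ * t → u₁ < L) := by
  have trapped : ∀ u₁ u₂ v₁ v₂ : ℝ,
      (v₁ ^ 2 + v₂ ^ 2) / 2 + ω ^ 2 / 2 * (u₁ - u1s) ^ 2 -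
          lam ^ 2 / 2 * (u₂ - u2s) ^ 2 ≤ 0 →
      u2s < u₂ → u₂ ≤ u₁ * t → u₁ ≤ u1p := by
    intro u₁ u₂ v₁ v₂ hE hu₂ hwall
    have hslope : δ * (u₁ - u1s) ≤ u₂ - u2s := by
      rw [hδ, div_mul_eq_mul_div, div_le_iff₀' hlam]
      exact omega_mul_sub_le_of_energy_nonpos hlam hE hu₂
    rw [hu1p, ← sub_le_iff_le_add', le_div_iff₀ (sub_pos.2 htδ)]
    linarith
  exact ⟨trapped, fun hL u₁ u₂ v₁ v₂ hE hu₂ hwall =>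
    (trapped u₁ u₂ v₁ v₂ hE hu₂ hwall).trans_lt hL⟩
end

section
/- Let ω, λ > 0, δ = ω/λ, and let τ = tan θ satisfy τ + δ > 0. Let u_{1s}, u_{2s} > 0 with u_{2s} > τ·u_{1s}, and set u₁⁻ = (u_{2s} + δ·u_{1s})/(τ + δ) = u_{1s} + (u_{2s} − τu_{1s})/(τ + δ). Suppose (u₁, u₂, v₁, v₂) ∈ ℝ⁴ satisfies H_lin(u₁, u₂, v₁, v₂) ≤ 0, u₂ < u_{2s}, and u₂ ≥ u₁·τ (i.e. the configuration point lies in the wedge, above the lower boundary ray u₂ = u₁ tan θ). Then u₁ ≤ u₁⁻. Consequently, when ω/λ is large enough that u₁⁻ < L, the lower branches of the stable and unstable manifolds of P cannot exit the corner region of size L through the reactant channel. -/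
/-- A phase point of nonpositive energy below the dividing line lies below the zero level line
of the potential through the saddle. -/
theorem mul_sub_le_of_energy_nonpos {ω lam u1s u2s u₁ u₂ v₁ v₂ : ℝ} (hlam : 0 < lam)
    (hH : (v₁ ^ 2 + v₂ ^ 2) / 2 + ω ^ 2 / 2 * (u₁ - u1s) ^ 2 -
      lam ^ 2 / 2 * (u₂ - u2s) ^ 2 ≤ 0) (hu₂ : u₂ < u2s) :
    ω * (u₁ - u1s) ≤ lam * (u2s - u₂) := by
  have hnonneg : 0 ≤ lam * (u2s - u₂) := mul_nonneg hlam.le (sub_nonneg.2 hu₂.le)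
  refine abs_le_of_sq_le_sq' ?_ hnonneg |>.2
  nlinarith [sq_nonneg v₁, sq_nonneg v₂]


/-- Trapping of the lower branches: if `δ = ω/λ`, `τ = tan θ` with `τ + δ > 0`,
`u_{2s} > τ·u_{1s}`, and a phase point has energy `H_lin ≤ 0`, lies below the
dividing line (`u₂ < u_{2s}`), and above the lower wall (`u₂ ≥ u₁·τ`), then
`u₁ ≤ u₁⁻ = (u_{2s} + δ·u_{1s})/(τ + δ)`. Consequently, when `ω/λ` is large
enough that `u₁⁻ < L`, the lower branches of the stable and unstable manifolds
of `P` cannot exit the corner region of size `L` through the reactant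
channel. -/
theorem lower_branches_trapped
    (ω lam u1s u2s L τ δ u1m : ℝ) (hω : 0 < ω) (hlam : 0 < lam)
    (hδ : δ = ω / lam) (hτδ : 0 < τ + δ)
    (h1s : 0 < u1s) (h2s : 0 < u2s) (hslope : τ * u1s < u2s)
    (hu1m : u1m = (u2s + δ * u1s) / (τ + δ)) :
    (∀ u₁ u₂ v₁ v₂ : ℝ,
      (v₁ ^ 2 + v₂ ^ 2) / 2 + ω ^ 2 / 2 * (u₁ - u1s) ^ 2 -
          lam ^ 2 / 2 * (u₂ - u2s) ^ 2 ≤ 0 →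
      u₂ < u2s → u₁ * τ ≤ u₂ → u₁ ≤ u1m) ∧
    (u1m < L →
      ∀ u₁ u₂ v₁ v₂ : ℝ,
        (v₁ ^ 2 + v₂ ^ 2) / 2 + ω ^ 2 / 2 * (u₁ - u1s) ^ 2 -
            lam ^ 2 / 2 * (u₂ - u2s) ^ 2 ≤ 0 →
        u₂ < u2s → u₁ * τ ≤ u₂ → u₁ < L) := by
  have trapped : ∀ u₁ u₂ v₁ v₂ : ℝ,
      (v₁ ^ 2 + v₂ ^ 2) / 2 + ω ^ 2 / 2 * (u₁ - u1s) ^ 2 -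
          lam ^ 2 / 2 * (u₂ - u2s) ^ 2 ≤ 0 →
      u₂ < u2s → u₁ * τ ≤ u₂ → u₁ ≤ u1m := by
    intro u₁ u₂ v₁ v₂ hH hu₂ hwall
    have hline : δ * (u₁ - u1s) ≤ u2s - u₂ := by
      rw [hδ, div_mul_eq_mul_div, div_le_iff₀' hlam]
      exact mul_sub_le_of_energy_nonpos hlam hH hu₂
    rw [hu1m, le_div_iff₀ hτδ]
    linarith
  exact ⟨trapped, fun hL u₁ u₂ v₁ v₂ hH hu₂ hwall =>
    (trapped u₁ u₂ v₁ v₂ hH hu₂ hwall).trans_lt hL⟩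
end

section
/- Let θ ∈ (−π/2, π/2), μ = tan θ, and let v̂₁, v̂₂ ∈ ℝ with v̂₂ ≠ 0. Set w₁ = v̂₁cos 2θ + v̂₂sin 2θ and w₂ = v̂₁sin 2θ − v̂₂cos 2θ, and assume w₂ ≠ 0. Then (1 − μ·w₁/w₂)·(cos 2θ − sin 2θ·v̂₁/v̂₂) = 1 − μ·v̂₁/v̂₂. (This identity expresses that the gluing map S_h defined by the reflection law from the slanted wall u₂ = μu₁ is symplectic with respect to the restriction of the form dv₁∧du₁ + μ·dv₂∧du₁ = (1 − μ v₁/v₂) dv₁∧du₁ to the energy-level cross-sections: the factor cos 2θ − sin 2θ·v̂₁/v̂₂ is the Jacobian determinant of S_h when v̂₂ is expressed from the energy.) -/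
theorem tan_mul_sin_two_mul {θ : ℝ} (h : Real.cos θ ≠ 0) :
    Real.tan θ * Real.sin (2 * θ) = 1 - Real.cos (2 * θ) := by
  rw [Real.tan_eq_sin_div_cos, Real.sin_two_mul, Real.cos_two_mul]
  field_simp
  linear_combination 2 * Real.sin_sq_add_cos_sq θ

theorem tan_mul_cos_two_mul {θ : ℝ} (h : Real.cos θ ≠ 0) :
    Real.tan θ * Real.cos (2 * θ) = Real.sin (2 * θ) - Real.tan θ := by
  rw [Real.tan_eq_sin_div_cos, Real.sin_two_mul, Real.cos_two_mul]
  field_simp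

/-- Symplecticity identity for the gluing map defined by reflection from the
slanted wall `u₂ = μu₁` (`μ = tan θ`): with `w₁ = v̂₁cos 2θ + v̂₂sin 2θ` and
`w₂ = v̂₁sin 2θ − v̂₂cos 2θ`, one has
`(1 − μ·w₁/w₂)(cos 2θ − sin 2θ·v̂₁/v̂₂) = 1 − μ·v̂₁/v̂₂`, which expresses that
the gluing map `S_h` is symplectic with respect to the restricted form
`(1 − μ v₁/v₂) dv₁∧du₁` on the energy-level cross-sections. -/
theorem gluing_map_symplectic_identity
    (θ μ v1 v2 w1 w2 : ℝ)
    (hθ : θ ∈ Set.Ioo (-(Real.pi / 2)) (Real.pi / 2)) (hμ : μ = Real.tan θ)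
    (hv2 : v2 ≠ 0)
    (hw1 : w1 = v1 * Real.cos (2 * θ) + v2 * Real.sin (2 * θ))
    (hw2 : w2 = v1 * Real.sin (2 * θ) - v2 * Real.cos (2 * θ))
    (hw2ne : w2 ≠ 0) :
    (1 - μ * w1 / w2) * (Real.cos (2 * θ) - Real.sin (2 * θ) * v1 / v2) =
      1 - μ * v1 / v2 := by
  have hc : Real.cos θ ≠ 0 := (Real.cos_pos_of_mem_Ioo hθ).ne'
  have key : μ * w1 - w2 = v2 - μ * v1 := by
    rw [hw1, hw2, hμ]
    linear_combination v1 * tan_mul_cos_two_mul hc + v2 * tan_mul_sin_two_mul hc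
  have jac : Real.cos (2 * θ) - Real.sin (2 * θ) * v1 / v2 = -w2 / v2 := by
    rw [hw2]
    field_simp
    ring
  rw [jac]
  field_simp
  linear_combination key
end
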